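/- arXiv:1111.5652 — 4 statements merged into one kernel-verified Lean document; each statement's English description precedes it below -/
import Mathlib

section
/- Let E be a finite set of equations between ground terms over a first-order signature of function symbols, and let T be a finite set of ground terms that is closed under subterms and contains all terms occurring in E. Let ∼ be the congruence closure of E on T, i.e. the smallest equivalence relation on T that contains every pair (s,t) with (s = t) ∈ E and is closed under congruence: whenever f(s₁,…,s_k) ∈ T, f(t₁,…,t_k) ∈ T and sᵢ ∼ tᵢ for all i ≤ k, then f(s₁,…,s_k) ∼ f(t₁,…,t_k). Then for all s, t ∈ T: E ⊨ s = t if and only if s ∼ t. -/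
open FirstOrder Language

/-- Value of a ground term in a structure. -/
def gval {L : Language} (M : Type) (str : L.Structure M) (t : L.Term Empty) : M :=
  letI := str
  t.realize Empty.elim

/-- `E ⊨ s = t`: every (nonempty) structure satisfying all equations of `E`
satisfies the equation `s = t`.  Equations between ground terms are represented
as pairs of ground terms. -/
def EntailsEq {L : Language} (E : Set (L.Term Empty × L.Term Empty))
    (s t : L.Term Empty) : Prop :=
  ∀ (M : Type) (str : L.Structure M), Nonempty M →
    (∀ p ∈ E, gval M str p.1 = gval M str p.2) →
    gval M str s = gval M str t

/-- `r` is an equivalence relation on `T` that contains every pair of `E` and is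
closed under congruence on `T`. -/
def IsCongClosed {L : Language} (E : Set (L.Term Empty × L.Term Empty))
    (T : Set (L.Term Empty)) (r : L.Term Empty → L.Term Empty → Prop) : Prop :=
  (∀ s ∈ T, r s s) ∧
  (∀ s t, r s t → r t s) ∧
  (∀ s t u, r s t → r t u → r s u) ∧
  (∀ p ∈ E, r p.1 p.2) ∧
  (∀ (k : ℕ) (f : L.Functions k) (s t : Fin k → L.Term Empty),
    Term.func f s ∈ T → Term.func f t ∈ T → (∀ i, r (s i) (t i)) →
    r (Term.func f s) (Term.func f t))

theorem gval_func {L : Language} (M : Type) (str : L.Structure M) {k : ℕ}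
    (f : L.Functions k) (ts : Fin k → L.Term Empty) :
    gval M str (Term.func f ts) = str.funMap f (fun i => gval M str (ts i)) := rfl

/-- Semantic entailment is itself closed under the rules of congruence closure. -/
theorem isCongClosed_entailsEq {L : Language} (E : Set (L.Term Empty × L.Term Empty))
    (T : Set (L.Term Empty)) : IsCongClosed E T (EntailsEq E) := by
  refine ⟨fun s _ M str _ _ => rfl, fun s t h M str hM hE => (h M str hM hE).symm,
    fun s t u h h' M str hM hE => (h M str hM hE).trans (h' M str hM hE),
    fun p hp M str _ hE => hE p hp, fun k f s t _ _ h M str hM hE => ?_⟩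
  rw [gval_func, gval_func]
  congr 1
  funext i
  exact h i M str hM hE

/-- A labelling `c` of a subterm-closed set `T` that respects the function symbols on `T`
is the evaluation of some structure on the labels. -/
theorem exists_structure_gval_eq {L : Language} {T : Set (L.Term Empty)}
    (hsub : ∀ (k : ℕ) (f : L.Functions k) (ts : Fin k → L.Term Empty),
      Term.func f ts ∈ T → ∀ i, ts i ∈ T)
    {M : Type} [Nonempty M] (c : L.Term Empty → M)
    (hc : ∀ (k : ℕ) (f : L.Functions k) (s t : Fin k → L.Term Empty),
      Term.func f s ∈ T → Term.func f t ∈ T → (∀ i, c (s i) = c (t i)) →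
      c (Term.func f s) = c (Term.func f t)) :
    ∃ str : L.Structure M, ∀ t ∈ T, gval M str t = c t := by
  classical
  let str : L.Structure M :=
    { funMap := fun {k} f xs =>
        if h : ∃ ts : Fin k → L.Term Empty, Term.func f ts ∈ T ∧ ∀ i, c (ts i) = xs i
        then c (Term.func f h.choose) else Classical.arbitrary M
      RelMap := fun _ _ => False }
  refine ⟨str, fun t => ?_⟩
  induction t with
  | var x => exact x.elim
  | func f ts ih =>
    intro ht
    have hargs : (fun i => gval M str (ts i)) = fun i => c (ts i) :=
      funext fun i => ih i (hsub _ f ts ht i)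
    have h : ∃ us, Term.func f us ∈ T ∧ ∀ i, c (us i) = c (ts i) := ⟨ts, ht, fun _ => rfl⟩
    rw [gval_func, hargs]
    exact (dif_pos h).trans (hc _ f _ ts h.choose_spec.1 ht h.choose_spec.2)

/-- An equivalence relation on a nonempty finite set `T` is the kernel on `T` of a labelling
by a small type. -/
theorem exists_labelling_of_finite {α : Type*} {T : Set α} (hT : T.Finite) (hne : T.Nonempty)
    {r : α → α → Prop} (hrefl : ∀ s ∈ T, r s s) (hsymm : ∀ s t, r s t → r t s)
    (htrans : ∀ s t u, r s t → r t u → r s u) :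
    ∃ (M : Type) (c : α → M), ∀ s ∈ T, ∀ t ∈ T, (c s = c t ↔ r s t) := by
  classical
  have : Finite T := hT
  let S : Setoid T :=
    ⟨fun s t => r s t, fun s => hrefl s s.2, fun h => hsymm _ _ h, fun h h' => htrans _ _ _ h h'⟩
  obtain ⟨n, ⟨e⟩⟩ := Finite.exists_equiv_fin (Quotient S)
  obtain ⟨a, ha⟩ := hne
  refine ⟨Fin n, fun s => e (Quotient.mk S (if h : s ∈ T then ⟨s, h⟩ else ⟨a, ha⟩)),
    fun s hs t ht => ?_⟩
  simp only [dif_pos hs, dif_pos ht, e.apply_eq_iff_eq]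
  exact Quotient.eq

/-- Let `E` be a finite set of ground equations and `T` a finite
subterm-closed set of ground terms containing all terms occurring in `E`.  If `sim`
is the congruence closure of `E` on `T` (the smallest equivalence relation on `T`
containing the pairs of `E` and closed under congruence), then for all `s, t ∈ T`,
`E ⊨ s = t` if and only if `s ∼ t`. -/
theorem congruence_closure_characterizes_entailment
    {L : Language} (E : Set (L.Term Empty × L.Term Empty)) (T : Set (L.Term Empty))
    (hEfin : E.Finite) (hTfin : T.Finite)
    (hsub : ∀ (k : ℕ) (f : L.Functions k) (ts : Fin k → L.Term Empty),
      Term.func f ts ∈ T → ∀ i, ts i ∈ T)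
    (hET : ∀ p ∈ E, p.1 ∈ T ∧ p.2 ∈ T)
    (sim : L.Term Empty → L.Term Empty → Prop)
    (hsimT : ∀ s t, sim s t → s ∈ T ∧ t ∈ T)
    (hsim : IsCongClosed E T sim)
    (hleast : ∀ r, IsCongClosed E T r → ∀ s t, sim s t → r s t) :
    ∀ s ∈ T, ∀ t ∈ T, (EntailsEq E s t ↔ sim s t) := by
  intro s hs t ht
  refine ⟨fun hent => ?_, hleast _ (isCongClosed_entailsEq E T) s t⟩
  obtain ⟨hrefl, hsymm, htrans, hE, hcong⟩ := hsim
  obtain ⟨M, c, hc⟩ := exists_labelling_of_finite hTfin ⟨s, hs⟩ hrefl hsymm htrans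
  have : Nonempty M := ⟨c s⟩
  obtain ⟨str, hstr⟩ := exists_structure_gval_eq hsub c fun k f u v hu hv h =>
    (hc _ hu _ hv).2 <| hcong k f u v hu hv fun i =>
      (hc _ (hsub k f u hu i) _ (hsub k f v hv i)).1 (h i)
  have key := hent M str this fun p hp => by
    rw [hstr _ (hET p hp).1, hstr _ (hET p hp).2]
    exact (hc _ (hET p hp).1 _ (hET p hp).2).2 (hE p hp)
  rw [hstr s hs, hstr t ht] at key
  exact (hc s hs t ht).1 key
end

section
/- Let E be a finite set of equations between ground terms over a first-order signature of function symbols, and let T be a finite set of ground terms that is closed under subterms and contains all terms occurring in E. Let ∼ be the congruence closure of E on T, i.e. the smallest equivalence relation on T that contains every pair (s,t) with (s = t) ∈ E and is closed under congruence: whenever f(s₁,…,s_k) ∈ T, f(t₁,…,t_k) ∈ T and sᵢ ∼ tᵢ for all i ≤ k, then f(s₁,…,s_k) ∼ f(t₁,…,t_k). Then the set of sentences E ∪ { s ≠ t | s, t ∈ T and not s ∼ t } is satisfiable. -/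
open FirstOrder Language

/-- The code of the class of `t` under `sim`: the set of labels of the terms related to `t`. -/
def classCode {L : Language} (g : L.Term Empty → ℕ) (sim : L.Term Empty → L.Term Empty → Prop)
    (t : L.Term Empty) : Set ℕ :=
  g '' {u | sim t u}

/-- The structure on sets of labels in which `f` sends the codes of the classes of the arguments of
a term `f(t₁, …, t_k) ∈ T` to the code of the class of that term, and all other tuples to `∅`. -/
abbrev classStructure {L : Language} (g : L.Term Empty → ℕ) (T : Set (L.Term Empty))
    (sim : L.Term Empty → L.Term Empty → Prop) : L.Structure (Set ℕ) where
  funMap {_} f x := {n | ∃ ts, Term.func f ts ∈ T ∧ (∀ i, classCode g sim (ts i) = x i) ∧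
    n ∈ classCode g sim (Term.func f ts)}
  RelMap _ _ := False

section

variable {L : Language} {E : Set (L.Term Empty × L.Term Empty)} {T : Set (L.Term Empty)}
  {sim : L.Term Empty → L.Term Empty → Prop} {g : L.Term Empty → ℕ}

theorem classCode_eq_iff (hsimT : ∀ s t, sim s t → s ∈ T ∧ t ∈ T) (hsim : IsCongClosed E T sim)
    (hg : Set.InjOn g T) {s t : L.Term Empty} (ht : t ∈ T) :
    classCode g sim s = classCode g sim t ↔ sim s t := by
  obtain ⟨hrefl, hsymm, htrans, -, -⟩ := hsim
  constructor
  · intro h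
    have hmem : g t ∈ classCode g sim s := h ▸ ⟨t, hrefl t ht, rfl⟩
    obtain ⟨u, hu, hgu⟩ := hmem
    rwa [← hg (hsimT s u hu).2 ht hgu]
  · intro h
    refine congrArg (g '' ·) (Set.ext fun u => ?_)
    exact ⟨htrans t s u (hsymm s t h), htrans s t u h⟩

theorem gval_classStructure
    (hsub : ∀ (k : ℕ) (f : L.Functions k) (ts : Fin k → L.Term Empty),
      Term.func f ts ∈ T → ∀ i, ts i ∈ T)
    (hsimT : ∀ s t, sim s t → s ∈ T ∧ t ∈ T) (hsim : IsCongClosed E T sim)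
    (hg : Set.InjOn g T) {t : L.Term Empty} (ht : t ∈ T) :
    gval (Set ℕ) (classStructure g T sim) t = classCode g sim t := by
  induction t with
  | var x => exact x.elim
  | @func k f ts ih =>
    have hval i : gval (Set ℕ) (classStructure g T sim) (ts i) = classCode g sim (ts i) :=
      ih i (hsub k f ts ht i)
    change {n | ∃ us, Term.func f us ∈ T ∧
      (∀ i, classCode g sim (us i) = gval (Set ℕ) (classStructure g T sim) (ts i)) ∧
      n ∈ classCode g sim (Term.func f us)} = _
    simp only [hval]
    ext n
    constructor
    · rintro ⟨us, hus, hargs, hn⟩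
      have hcong : sim (Term.func f us) (Term.func f ts) :=
        hsim.2.2.2.2 k f us ts hus ht fun i =>
          (classCode_eq_iff hsimT hsim hg (hsub k f ts ht i)).1 (hargs i)
      rwa [← (classCode_eq_iff hsimT hsim hg ht).2 hcong]
    · exact fun hn => ⟨ts, ht, fun _ => rfl, hn⟩

end

/-- Let `E` be a finite set of ground equations and `T` a finite
subterm-closed set of ground terms containing all terms occurring in `E`, and let
`sim` be the congruence closure of `E` on `T`.  Then the set of sentences
`E ∪ { s ≠ t | s, t ∈ T, ¬ s ∼ t }` is satisfiable: some nonempty structure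
satisfies all equations of `E` and all the disequations `s ≠ t` for `s, t ∈ T`
with `¬ s ∼ t`. -/
theorem congruence_closure_satisfiable
    {L : Language} (E : Set (L.Term Empty × L.Term Empty)) (T : Set (L.Term Empty))
    (hEfin : E.Finite) (hTfin : T.Finite)
    (hsub : ∀ (k : ℕ) (f : L.Functions k) (ts : Fin k → L.Term Empty),
      Term.func f ts ∈ T → ∀ i, ts i ∈ T)
    (hET : ∀ p ∈ E, p.1 ∈ T ∧ p.2 ∈ T)
    (sim : L.Term Empty → L.Term Empty → Prop)
    (hsimT : ∀ s t, sim s t → s ∈ T ∧ t ∈ T)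
    (hsim : IsCongClosed E T sim)
    (hleast : ∀ r, IsCongClosed E T r → ∀ s t, sim s t → r s t) :
    ∃ (M : Type) (str : L.Structure M), Nonempty M ∧
      (∀ p ∈ E, gval M str p.1 = gval M str p.2) ∧
      (∀ s ∈ T, ∀ t ∈ T, ¬ sim s t → gval M str s ≠ gval M str t) := by
  obtain ⟨g, hg⟩ := Set.countable_iff_exists_injOn.1 hTfin.countable
  have hval {t} (ht : t ∈ T) := gval_classStructure hsub hsimT hsim hg ht
  refine ⟨Set ℕ, classStructure g T sim, inferInstance, fun p hp => ?_, fun s hs t ht hst h => ?_⟩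
  · obtain ⟨h₁, h₂⟩ := hET p hp
    rw [hval h₁, hval h₂, classCode_eq_iff hsimT hsim hg h₂]
    exact hsim.2.2.2.1 p hp
  · rw [hval hs, hval ht, classCode_eq_iff hsimT hsim hg ht] at h
    exact hst h
end

section
/- Let L be a finite set of ground equality literals (equations s = t and disequations s ≠ t between ground terms) over a first-order signature of function symbols, and let L_= denote the set of equations in L. Then L is satisfiable in first-order logic with equality if and only if for every disequation (s ≠ t) ∈ L, L_= does not entail s = t (i.e. some structure satisfies L_= but not s = t). -/
open FirstOrder Language

/-- A ground equality literal: `(true, s, t)` represents the equation `s = t`,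
and `(false, s, t)` represents the disequation `s ≠ t`. -/
abbrev GLit (L : Language) := Bool × L.Term Empty × L.Term Empty

/-- Truth of a ground equality literal in a structure. -/
def LitHolds {L : Language} (M : Type) (str : L.Structure M) (l : GLit L) : Prop :=
  if l.1 then gval M str l.2.1 = gval M str l.2.2
  else gval M str l.2.1 ≠ gval M str l.2.2

/-- The product of a family of structures, with pointwise functions and empty relations. -/
@[reducible] def piStructure {L : Language} {ι : Type} (M : ι → Type)
    (str : ∀ i, L.Structure (M i)) : L.Structure (∀ i, M i) where
  funMap f x i := (str i).funMap f fun k => x k i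
  RelMap _ _ := False

theorem gval_piStructure {L : Language} {ι : Type} (M : ι → Type)
    (str : ∀ i, L.Structure (M i)) (t : L.Term Empty) (i : ι) :
    gval (∀ i, M i) (piStructure M str) t i = gval (M i) (str i) t := by
  induction t with
  | var a => exact a.elim
  | func f ts ih => exact congrArg ((str i).funMap f) (funext ih)

/-- A finite set `Lset` of ground equality literals is satisfiable
if and only if for every disequation `s ≠ t` in `Lset`, the set `Lset_=` of equations
of `Lset` does not entail `s = t`. -/
theorem ground_literals_sat_iff
    {L : Language} (Lset : Set (GLit L)) (hfin : Lset.Finite) :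
    (∃ (M : Type) (str : L.Structure M), Nonempty M ∧ ∀ l ∈ Lset, LitHolds M str l) ↔
      (∀ l ∈ Lset, l.1 = false →
        ¬ EntailsEq {p : L.Term Empty × L.Term Empty | (true, p.1, p.2) ∈ Lset}
          l.2.1 l.2.2) := by
  constructor
  · rintro ⟨M, str, hM, h⟩ ⟨b, s, t⟩ hl rfl hent
    exact h _ hl (hent M str hM fun p hp => h _ hp)
  · intro h
    have : Finite {l // l ∈ Lset ∧ l.1 = false} :=
      (hfin.subset fun _ hl => hl.1 : {l | l ∈ Lset ∧ l.1 = false}.Finite)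
    obtain ⟨n, ⟨e⟩⟩ := Finite.exists_equiv_fin {l // l ∈ Lset ∧ l.1 = false}
    have hcounter := fun i : Fin n => h (e.symm i).1 (e.symm i).2.1 (e.symm i).2.2
    simp only [EntailsEq, not_forall] at hcounter
    choose M str hM heq hne using hcounter
    refine ⟨∀ i, M i, piStructure M str, ⟨fun i => (hM i).some⟩, ?_⟩
    rintro ⟨b, s, t⟩ hl
    cases b with
    | true =>
      refine funext fun i => ?_
      rw [gval_piStructure, gval_piStructure]
      exact heq i (s, t) hl
    | false =>
      intro hst
      have hne' := hne (e ⟨_, hl, rfl⟩)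
      rw [e.symm_apply_apply] at hne'
      apply hne'
      rw [← gval_piStructure M str s, ← gval_piStructure M str t]
      exact congrFun hst _
end

section
/- Let 𝒯 be a first-order theory over a signature Σ. Suppose that every pair (A, B) of finite sets of ground literals over expansions of Σ by free (non-theory) symbols such that A ∪ B is 𝒯-unsatisfiable has a quantifier-free interpolant: a quantifier-free sentence I all of whose non-theory symbols occur in both A and B, with A ⊨_𝒯 I and B ∪ {I} 𝒯-unsatisfiable. Then 𝒯 has the ground interpolation property: for every pair (A, B) of quantifier-free sentences (over expansions of Σ by free symbols) such that {A, B} is 𝒯-unsatisfiable, there exists a quantifier-free sentence I all of whose non-theory symbols occur in both A and B such that A ⊨_𝒯 I and {B, I} is 𝒯-unsatisfiable. -/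
open FirstOrder Language

/-- A function symbol (paired with its arity) occurs in a term. -/
inductive TFunc {L : Language} {α : Type*} : (Σ n, L.Functions n) → L.Term α → Prop
  | head {k : ℕ} (f : L.Functions k) (ts : Fin k → L.Term α) : TFunc ⟨k, f⟩ (Term.func f ts)
  | arg {k : ℕ} (f : L.Functions k) (ts : Fin k → L.Term α) (i : Fin k) {g} :
      TFunc g (ts i) → TFunc g (Term.func f ts)

/-- A function symbol occurs in a bounded formula. -/
inductive FFunc {L : Language} {α : Type*} :
    ∀ {n : ℕ}, (Σ k, L.Functions k) → L.BoundedFormula α n → Prop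
  | equal_l {n} {t₁ t₂ : L.Term (α ⊕ Fin n)} {g} (h : TFunc g t₁) :
      FFunc g (BoundedFormula.equal t₁ t₂)
  | equal_r {n} {t₁ t₂ : L.Term (α ⊕ Fin n)} {g} (h : TFunc g t₂) :
      FFunc g (BoundedFormula.equal t₁ t₂)
  | rel {n l : ℕ} {R : L.Relations l} {ts : Fin l → L.Term (α ⊕ Fin n)} {g} (i : Fin l)
      (h : TFunc g (ts i)) : FFunc g (BoundedFormula.rel R ts)
  | imp_l {n} {φ ψ : L.BoundedFormula α n} {g} (h : FFunc g φ) : FFunc g (φ.imp ψ)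
  | imp_r {n} {φ ψ : L.BoundedFormula α n} {g} (h : FFunc g ψ) : FFunc g (φ.imp ψ)
  | all {n} {φ : L.BoundedFormula α (n + 1)} {g} (h : FFunc g φ) : FFunc g φ.all

/-- A relation symbol occurs in a bounded formula. -/
inductive FRel {L : Language} {α : Type*} :
    ∀ {n : ℕ}, (Σ k, L.Relations k) → L.BoundedFormula α n → Prop
  | rel {n l : ℕ} {R : L.Relations l} {ts : Fin l → L.Term (α ⊕ Fin n)} :
      FRel ⟨l, R⟩ (BoundedFormula.rel R ts)
  | imp_l {n} {φ ψ : L.BoundedFormula α n} {g} (h : FRel g φ) : FRel g (φ.imp ψ)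
  | imp_r {n} {φ ψ : L.BoundedFormula α n} {g} (h : FRel g ψ) : FRel g (φ.imp ψ)
  | all {n} {φ : L.BoundedFormula α (n + 1)} {g} (h : FRel g φ) : FRel g φ.all

/-- A structure (given explicitly) satisfies every sentence in `S`. -/
def SatisfiesAll {L : Language} (M : Type) (str : L.Structure M) (S : Set L.Sentence) : Prop :=
  letI := str
  ∀ φ ∈ S, M ⊨ φ

/-- `S ⊨_T φ` : semantic entailment modulo the theory `T`. -/
def TEntails {L : Language} (T : L.Theory) (S : Set L.Sentence) (φ : L.Sentence) : Prop :=
  ∀ (M : Type) (str : L.Structure M), Nonempty M →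
    SatisfiesAll M str T → SatisfiesAll M str S → (letI := str; M ⊨ φ)

/-- `T`-unsatisfiability of a set of sentences. -/
def TUnsat {L : Language} (T : L.Theory) (S : Set L.Sentence) : Prop :=
  ∀ (M : Type) (str : L.Structure M), Nonempty M →
    SatisfiesAll M str T → ¬ SatisfiesAll M str S

/-- The theory uses only symbols of the signature given by `SF`, `SR`. -/
def TheoryOverSig {L : Language} (SF : Set (Σ k, L.Functions k))
    (SR : Set (Σ k, L.Relations k)) (T : L.Theory) : Prop :=
  ∀ φ ∈ T, (∀ g, FFunc g φ → g ∈ SF) ∧ (∀ g, FRel g φ → g ∈ SR)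

/-- A ground literal: an atomic sentence or a negated atomic sentence. -/
def IsGroundLiteral {L : Language} (φ : L.Sentence) : Prop :=
  BoundedFormula.IsAtomic φ ∨
    ∃ ψ : L.Sentence, BoundedFormula.IsAtomic ψ ∧ φ = BoundedFormula.not ψ

/-- Every non-theory symbol of `I` occurs both in `A` and in `B`. -/
def SharedSymbols {L : Language} (SF : Set (Σ k, L.Functions k))
    (SR : Set (Σ k, L.Relations k)) (A B : Set L.Sentence) (I : L.Sentence) : Prop :=
  (∀ g, FFunc g I → g ∉ SF → (∃ ψ ∈ A, FFunc g ψ) ∧ ∃ ψ ∈ B, FFunc g ψ) ∧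
  (∀ g, FRel g I → g ∉ SR → (∃ ψ ∈ A, FRel g ψ) ∧ ∃ ψ ∈ B, FRel g ψ)

/-- `φ` is equivalent to the disjunction over `S ∈ D` of the conjunctions of the literals in `S`,
for a finite family `D` of finite sets of ground literals using only symbols of `φ`. -/
def HasDNF {L : Language} (φ : L.Sentence) : Prop :=
  ∃ D : Set (Set L.Sentence), D.Finite ∧
    (∀ S ∈ D, S.Finite ∧ ∀ l ∈ S, IsGroundLiteral l ∧
      (∀ g, FFunc g l → FFunc g φ) ∧ ∀ g, FRel g l → FRel g φ) ∧
    ∀ (M : Type) (str : L.Structure M), (letI := str; M ⊨ φ) ↔ ∃ S ∈ D, SatisfiesAll M str S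

namespace HasDNF

variable {L : Language} {φ ψ χ : L.Sentence}

theorem of_literal (h : IsGroundLiteral φ) : HasDNF φ :=
  ⟨{{φ}}, Set.finite_singleton _, by simp [h], fun M str => by simp [SatisfiesAll]⟩

theorem of_forall_not (h : ∀ (M : Type) (str : L.Structure M), ¬ (letI := str; M ⊨ φ)) :
    HasDNF φ :=
  ⟨∅, Set.finite_empty, by simp, fun M str => by simpa using h M str⟩

theorem of_forall (h : ∀ (M : Type) (str : L.Structure M), (letI := str; M ⊨ φ)) :
    HasDNF φ :=
  ⟨{∅}, Set.finite_singleton _, by simp, fun M str => by simpa [SatisfiesAll] using h M str⟩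

theorem of_or (hφ : HasDNF φ) (hψ : HasDNF ψ)
    (hF : ∀ g, FFunc g φ ∨ FFunc g ψ → FFunc g χ) (hR : ∀ g, FRel g φ ∨ FRel g ψ → FRel g χ)
    (h : ∀ (M : Type) (str : L.Structure M),
      (letI := str; M ⊨ χ) ↔ (letI := str; M ⊨ φ) ∨ (letI := str; M ⊨ ψ)) :
    HasDNF χ := by
  obtain ⟨D, hD, hDl, hDs⟩ := hφ
  obtain ⟨E, hE, hEl, hEs⟩ := hψ
  refine ⟨D ∪ E, hD.union hE, ?_, fun M str => ?_⟩
  · rintro S (hS | hS)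
    · exact ⟨(hDl S hS).1, fun l hl => ⟨((hDl S hS).2 l hl).1,
        fun g hg => hF g (.inl (((hDl S hS).2 l hl).2.1 g hg)),
        fun g hg => hR g (.inl (((hDl S hS).2 l hl).2.2 g hg))⟩⟩
    · exact ⟨(hEl S hS).1, fun l hl => ⟨((hEl S hS).2 l hl).1,
        fun g hg => hF g (.inr (((hEl S hS).2 l hl).2.1 g hg)),
        fun g hg => hR g (.inr (((hEl S hS).2 l hl).2.2 g hg))⟩⟩
  · rw [h, hDs, hEs]
    simp only [Set.mem_union, or_and_right, exists_or]

theorem of_and (hφ : HasDNF φ) (hψ : HasDNF ψ)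
    (hF : ∀ g, FFunc g φ ∨ FFunc g ψ → FFunc g χ) (hR : ∀ g, FRel g φ ∨ FRel g ψ → FRel g χ)
    (h : ∀ (M : Type) (str : L.Structure M),
      (letI := str; M ⊨ χ) ↔ (letI := str; M ⊨ φ) ∧ (letI := str; M ⊨ ψ)) :
    HasDNF χ := by
  obtain ⟨D, hD, hDl, hDs⟩ := hφ
  obtain ⟨E, hE, hEl, hEs⟩ := hψ
  refine ⟨Set.image2 (· ∪ ·) D E, hD.image2 _ hE, ?_, fun M str => ?_⟩
  · rintro _ ⟨S, hS, S', hS', rfl⟩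
    refine ⟨(hDl S hS).1.union (hEl S' hS').1, ?_⟩
    rintro l (hl | hl)
    · exact ⟨((hDl S hS).2 l hl).1,
        fun g hg => hF g (.inl (((hDl S hS).2 l hl).2.1 g hg)),
        fun g hg => hR g (.inl (((hDl S hS).2 l hl).2.2 g hg))⟩
    · exact ⟨((hEl S' hS').2 l hl).1,
        fun g hg => hF g (.inr (((hEl S' hS').2 l hl).2.1 g hg)),
        fun g hg => hR g (.inr (((hEl S' hS').2 l hl).2.2 g hg))⟩
  · rw [h, hDs, hEs]
    constructor
    · rintro ⟨⟨S, hS, hSs⟩, S', hS', hSs'⟩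
      exact ⟨_, Set.mem_image2_of_mem hS hS', fun l hl => hl.elim (hSs l) (hSs' l)⟩
    · rintro ⟨_, ⟨S, hS, S', hS', rfl⟩, hs⟩
      exact ⟨⟨S, hS, fun l hl => hs l (.inl hl)⟩, S', hS', fun l hl => hs l (.inr hl)⟩

end HasDNF

theorem realize_imp_sentence {L : Language} (M : Type) (str : L.Structure M) (φ ψ : L.Sentence) :
    (letI := str; M ⊨ (BoundedFormula.imp φ ψ : L.Sentence)) ↔
      ((letI := str; M ⊨ φ) → (letI := str; M ⊨ ψ)) := Iff.rfl

theorem realize_not_sentence {L : Language} (M : Type) (str : L.Structure M) (φ : L.Sentence) :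
    (letI := str; M ⊨ (BoundedFormula.not φ : L.Sentence)) ↔ ¬ (letI := str; M ⊨ φ) := Iff.rfl

theorem not_realize_falsum_sentence {L : Language} (M : Type) (str : L.Structure M) :
    ¬ (letI := str; M ⊨ (BoundedFormula.falsum : L.Sentence)) := fun h => h

section Occurrence

variable {L : Language} {φ ψ : L.Sentence}

theorem not_fFunc_falsum {g : Σ k, L.Functions k} :
    ¬ FFunc g (BoundedFormula.falsum : L.Sentence) := nofun

theorem not_fRel_falsum {g : Σ k, L.Relations k} :
    ¬ FRel g (BoundedFormula.falsum : L.Sentence) := nofun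

theorem fFunc_imp_iff {g : Σ k, L.Functions k} :
    FFunc g (BoundedFormula.imp φ ψ : L.Sentence) ↔ FFunc g φ ∨ FFunc g ψ :=
  ⟨fun h => by cases h with | imp_l h => exact .inl h | imp_r h => exact .inr h,
    fun h => h.elim .imp_l .imp_r⟩

theorem fRel_imp_iff {g : Σ k, L.Relations k} :
    FRel g (BoundedFormula.imp φ ψ : L.Sentence) ↔ FRel g φ ∨ FRel g ψ :=
  ⟨fun h => by cases h with | imp_l h => exact .inl h | imp_r h => exact .inr h,
    fun h => h.elim .imp_l .imp_r⟩

theorem fFunc_not_iff {g : Σ k, L.Functions k} :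
    FFunc g (BoundedFormula.not φ : L.Sentence) ↔ FFunc g φ :=
  fFunc_imp_iff.trans (or_iff_left not_fFunc_falsum)

theorem fRel_not_iff {g : Σ k, L.Relations k} :
    FRel g (BoundedFormula.not φ : L.Sentence) ↔ FRel g φ :=
  fRel_imp_iff.trans (or_iff_left not_fRel_falsum)

end Occurrence

theorem hasDNF_and_hasDNF_not {L : Language} {φ : L.Sentence} (h : BoundedFormula.IsQF φ) :
    HasDNF φ ∧ HasDNF (BoundedFormula.not φ : L.Sentence) := by
  induction h with
  | falsum =>
    exact ⟨.of_forall_not not_realize_falsum_sentence, .of_forall fun _ _ h => h⟩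
  | of_isAtomic h => exact ⟨.of_literal (.inl h), .of_literal (.inr ⟨_, h, rfl⟩)⟩
  | @imp φ ψ _ _ ihφ ihψ =>
    refine ⟨ihφ.2.of_or ihψ.1 ?_ ?_ fun M str => ?_, ihφ.1.of_and ihψ.2 ?_ ?_ fun M str => ?_⟩
    · exact fun g h => fFunc_imp_iff.2 (h.imp_left fFunc_not_iff.1)
    · exact fun g h => fRel_imp_iff.2 (h.imp_left fRel_not_iff.1)
    · rw [realize_imp_sentence, realize_not_sentence, imp_iff_not_or]
    · exact fun g h => fFunc_not_iff.2 (fFunc_imp_iff.2 (h.imp_right fFunc_not_iff.1))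
    · exact fun g h => fRel_not_iff.2 (fRel_imp_iff.2 (h.imp_right fRel_not_iff.1))
    · rw [realize_not_sentence, realize_imp_sentence, realize_not_sentence, Classical.not_imp]

namespace SharedSymbols

variable {L : Language} {SF : Set (Σ k, L.Functions k)} {SR : Set (Σ k, L.Relations k)}
  {A B A' B' : Set L.Sentence} {I J : L.Sentence}

theorem falsum : SharedSymbols SF SR A B BoundedFormula.falsum :=
  ⟨fun _ h => (not_fFunc_falsum h).elim, fun _ h => (not_fRel_falsum h).elim⟩

theorem imp (hI : SharedSymbols SF SR A B I) (hJ : SharedSymbols SF SR A B J) :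
    SharedSymbols SF SR A B (BoundedFormula.imp I J) :=
  ⟨fun g h => (fFunc_imp_iff.1 h).elim (hI.1 g) (hJ.1 g),
    fun g h => (fRel_imp_iff.1 h).elim (hI.2 g) (hJ.2 g)⟩

theorem not (hI : SharedSymbols SF SR A B I) : SharedSymbols SF SR A B (BoundedFormula.not I) :=
  hI.imp falsum

theorem mono (hI : SharedSymbols SF SR A B I)
    (hAF : ∀ ψ ∈ A, ∀ g, FFunc g ψ → ∃ χ ∈ A', FFunc g χ)
    (hAR : ∀ ψ ∈ A, ∀ g, FRel g ψ → ∃ χ ∈ A', FRel g χ)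
    (hBF : ∀ ψ ∈ B, ∀ g, FFunc g ψ → ∃ χ ∈ B', FFunc g χ)
    (hBR : ∀ ψ ∈ B, ∀ g, FRel g ψ → ∃ χ ∈ B', FRel g χ) :
    SharedSymbols SF SR A' B' I := by
  constructor
  · intro g hg hgS
    obtain ⟨⟨ψ, hψ, h⟩, χ, hχ, h'⟩ := hI.1 g hg hgS
    exact ⟨hAF ψ hψ g h, hBF χ hχ g h'⟩
  · intro g hg hgS
    obtain ⟨⟨ψ, hψ, h⟩, χ, hχ, h'⟩ := hI.2 g hg hgS
    exact ⟨hAR ψ hψ g h, hBR χ hχ g h'⟩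

end SharedSymbols

/-- Interpolants against each member of a finite family `E` conjoin to one against all of `E`. -/
theorem exists_interpolant_conj {L : Language} {SF : Set (Σ k, L.Functions k)}
    {SR : Set (Σ k, L.Relations k)} {T : L.Theory} {A B S : Set L.Sentence}
    {E : Set (Set L.Sentence)} (hE : E.Finite)
    (h : ∀ S' ∈ E, ∃ I : L.Sentence, BoundedFormula.IsQF I ∧ SharedSymbols SF SR A B I ∧
      TEntails T S I ∧ TUnsat T (S' ∪ {I})) :
    ∃ I : L.Sentence, BoundedFormula.IsQF I ∧ SharedSymbols SF SR A B I ∧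
      TEntails T S I ∧ ∀ S' ∈ E, TUnsat T (S' ∪ {I}) := by
  induction E, hE using Set.Finite.induction_on with
  | empty =>
    exact ⟨BoundedFormula.not BoundedFormula.falsum, .not .falsum, .not .falsum,
      fun _ _ _ _ _ h => h, by simp⟩
  | @insert a E _ _ ih =>
    obtain ⟨I, hIq, hIs, hIe, hIu⟩ := h a (.inl rfl)
    obtain ⟨J, hJq, hJs, hJe, hJu⟩ := ih fun S' hS' => h S' (.inr hS')
    refine ⟨BoundedFormula.not (BoundedFormula.imp I (BoundedFormula.not J)), (hIq.imp hJq.not).not,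
      (hIs.imp hJs.not).not, fun M str hM hMT hMS hn =>
        hn (hIe M str hM hMT hMS) (hJe M str hM hMT hMS), ?_⟩
    have key : ∀ (M : Type) (str : L.Structure M), (letI := str
        M ⊨ (BoundedFormula.not (BoundedFormula.imp I (BoundedFormula.not J)) : L.Sentence)) →
        (letI := str; M ⊨ I) ∧ (letI := str; M ⊨ J) := fun M str h => by
      rwa [realize_not_sentence, realize_imp_sentence, realize_not_sentence, Classical.not_imp,
        not_not] at h
    rintro S' (rfl | hS') M str hM hMT hMS
    · refine hIu M str hM hMT ?_
      rintro l (hl | rfl)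
      exacts [hMS l (.inl hl), (key M str (hMS _ (.inr rfl))).1]
    · refine hJu S' hS' M str hM hMT ?_
      rintro l (hl | rfl)
      exacts [hMS l (.inl hl), (key M str (hMS _ (.inr rfl))).2]

/-- Interpolants for each member of a finite family `D` disjoin to one for all of `D`. -/
theorem exists_interpolant_disj {L : Language} {SF : Set (Σ k, L.Functions k)}
    {SR : Set (Σ k, L.Relations k)} {T : L.Theory} {A B : Set L.Sentence}
    {D E : Set (Set L.Sentence)} (hD : D.Finite)
    (h : ∀ S ∈ D, ∃ I : L.Sentence, BoundedFormula.IsQF I ∧ SharedSymbols SF SR A B I ∧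
      TEntails T S I ∧ ∀ S' ∈ E, TUnsat T (S' ∪ {I})) :
    ∃ I : L.Sentence, BoundedFormula.IsQF I ∧ SharedSymbols SF SR A B I ∧
      (∀ S ∈ D, TEntails T S I) ∧ ∀ S' ∈ E, TUnsat T (S' ∪ {I}) := by
  induction D, hD using Set.Finite.induction_on with
  | empty =>
    exact ⟨BoundedFormula.falsum, .falsum, .falsum, by simp,
      fun S' _ M str _ _ hs => not_realize_falsum_sentence M str (hs _ (.inr rfl))⟩
  | @insert a D _ _ ih =>
    obtain ⟨I, hIq, hIs, hIe, hIu⟩ := h a (.inl rfl)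
    obtain ⟨J, hJq, hJs, hJe, hJu⟩ := ih fun S hS => h S (.inr hS)
    refine ⟨BoundedFormula.imp (BoundedFormula.not I) J, hIq.not.imp hJq, hIs.not.imp hJs, ?_, ?_⟩
    · rintro S (rfl | hS) M str hM hMT hMS
      · exact fun hn => (hn (hIe M str hM hMT hMS)).elim
      · exact fun _ => hJe S hS M str hM hMT hMS
    · intro S' hS' M str hM hMT hMS
      have hIJ := hMS _ (.inr rfl)
      by_cases hI : (letI := str; M ⊨ I)
      · refine hIu S' hS' M str hM hMT ?_
        rintro l (hl | rfl)
        exacts [hMS l (.inl hl), hI]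
      · refine hJu S' hS' M str hM hMT ?_
        rintro l (hl | rfl)
        exacts [hMS l (.inl hl), hIJ hI]

/-- If every pair of jointly `T`-unsatisfiable finite sets of ground
literals has a quantifier-free interpolant, then `T` has the ground interpolation
property: every pair of jointly `T`-unsatisfiable quantifier-free sentences has a
quantifier-free interpolant. -/
theorem ground_interpolation_from_literal_interpolation
    {L : Language} (SF : Set (Σ k, L.Functions k)) (SR : Set (Σ k, L.Relations k))
    (T : L.Theory) (hT : TheoryOverSig SF SR T)
    (hlit : ∀ A B : Set L.Sentence, A.Finite → B.Finite →
      (∀ φ ∈ A, IsGroundLiteral φ) → (∀ φ ∈ B, IsGroundLiteral φ) →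
      TUnsat T (A ∪ B) →
      ∃ I : L.Sentence, BoundedFormula.IsQF I ∧ SharedSymbols SF SR A B I ∧
        TEntails T A I ∧ TUnsat T (B ∪ {I})) :
    ∀ A B : L.Sentence, BoundedFormula.IsQF A → BoundedFormula.IsQF B →
      TUnsat T {A, B} →
      ∃ I : L.Sentence, BoundedFormula.IsQF I ∧ SharedSymbols SF SR {A} {B} I ∧
        TEntails T {A} I ∧ TUnsat T {B, I} := by
  intro A B hA hB hAB
  obtain ⟨D, hD, hDl, hDs⟩ := (hasDNF_and_hasDNF_not hA).1
  obtain ⟨E, hE, hEl, hEs⟩ := (hasDNF_and_hasDNF_not hB).1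
  obtain ⟨I, hIq, hIs, hIe, hIu⟩ : ∃ I : L.Sentence, BoundedFormula.IsQF I ∧
      SharedSymbols SF SR {A} {B} I ∧ (∀ S ∈ D, TEntails T S I) ∧
      ∀ S' ∈ E, TUnsat T (S' ∪ {I}) := by
    refine exists_interpolant_disj hD fun S hS => exists_interpolant_conj hE fun S' hS' => ?_
    obtain ⟨I, hIq, hIs, hIe, hIu⟩ := hlit S S' (hDl S hS).1 (hEl S' hS').1
      (fun l hl => ((hDl S hS).2 l hl).1) (fun l hl => ((hEl S' hS').2 l hl).1) (by
        intro M str hM hMT hMS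
        refine hAB M str hM hMT ?_
        rintro l (rfl | rfl)
        · exact (hDs M str).2 ⟨S, hS, fun l hl => hMS l (.inl hl)⟩
        · exact (hEs M str).2 ⟨S', hS', fun l hl => hMS l (.inr hl)⟩)
    refine ⟨I, hIq, hIs.mono ?_ ?_ ?_ ?_, hIe, hIu⟩
    · exact fun l hl g hg => ⟨A, rfl, ((hDl S hS).2 l hl).2.1 g hg⟩
    · exact fun l hl g hg => ⟨A, rfl, ((hDl S hS).2 l hl).2.2 g hg⟩
    · exact fun l hl g hg => ⟨B, rfl, ((hEl S' hS').2 l hl).2.1 g hg⟩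
    · exact fun l hl g hg => ⟨B, rfl, ((hEl S' hS').2 l hl).2.2 g hg⟩
  refine ⟨I, hIq, hIs, fun M str hM hMT hMA => ?_, fun M str hM hMT hMB => ?_⟩
  · obtain ⟨S, hS, hSs⟩ := (hDs M str).1 (hMA A rfl)
    exact hIe S hS M str hM hMT hSs
  · obtain ⟨S', hS', hSs⟩ := (hEs M str).1 (hMB B (.inl rfl))
    refine hIu S' hS' M str hM hMT ?_
    rintro l (hl | rfl)
    exacts [hSs l hl, hMB _ (.inr rfl)]
end
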